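/- arXiv:1302.3519 — 2 statements merged into one kernel-verified Lean document; each statement's English description precedes it below -/
import Mathlib

section
/- In any skew lattice: (a) the identities x∧y∧(x∨y∨x) = (x∨y∨x)∧y∧x (lower symmetry) and x∧(y∨z)∧x = (x∧y∧x)∨(x∧z∧x) (∧-middle-distributivity) together imply x∨(y∧z)∨x = (x∨y∨x)∧(x∨z∨x) (∨-middle-distributivity); and (b) the identities x∨y∨(x∧y∧x) = (x∧y∧x)∨y∨x (upper symmetry) and x∨(y∧z)∨x = (x∨y∨x)∧(x∨z∨x) together imply x∧(y∨z)∧x = (x∧y∧x)∨(x∧z∧x). -/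
/-- The pair of operations `m` (meet) and `j` (join) makes `S` a skew lattice. -/
structure IsSkewLattice {S : Type*} (m j : S → S → S) : Prop where
  meet_assoc : ∀ x y z : S, m x (m y z) = m (m x y) z
  join_assoc : ∀ x y z : S, j x (j y z) = j (j x y) z
  meet_join_self : ∀ x y : S, j (m y x) x = x
  self_meet_join : ∀ x y : S, m x (j x y) = x
  join_meet_self : ∀ x y : S, m (j y x) x = x
  self_join_meet : ∀ x y : S, j x (m x y) = x

/-- If `a` and `b` are `R`-related and `b` and `c` are `L`-related, then `a c = b`. -/
theorem mul_eq_of_greenR_of_greenL {S : Type*} {f : S → S → S}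
    (assoc : ∀ x y z, f x (f y z) = f (f x y) z) (idem : ∀ x, f x x = x) {a b c : S}
    (hab : f a b = b) (hba : f b a = a) (hbc : f b c = b) (hcb : f c b = c) : f a c = b := by
  have : Std.Associative f := ⟨fun x y z => (assoc x y z).symm⟩
  have := idem (f c a)
  grind only

namespace IsSkewLattice

variable {S : Type*} {m j : S → S → S}

local notation:70 x:70 "⋏" y:71 => m x y
local notation:65 x:65 "⋎" y:66 => j x y

theorem dual (h : IsSkewLattice m j) : IsSkewLattice j m :=
  ⟨h.join_assoc, h.meet_assoc, h.join_meet_self, h.self_join_meet, h.meet_join_self,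
    h.self_meet_join⟩

theorem reverse (h : IsSkewLattice m j) :
    IsSkewLattice (fun x y => m y x) (fun x y => j y x) :=
  ⟨fun x y z => (h.meet_assoc z y x).symm, fun x y z => (h.join_assoc z y x).symm,
    h.self_join_meet, h.join_meet_self, h.self_meet_join, h.meet_join_self⟩

theorem meet_associative (h : IsSkewLattice m j) : Std.Associative m :=
  ⟨fun x y z => (h.meet_assoc x y z).symm⟩

theorem meet_self (h : IsSkewLattice m j) (x : S) : x ⋏ x = x := by
  simpa only [h.self_join_meet] using h.self_meet_join x (x ⋏ x)

theorem join_eq_left (h : IsSkewLattice m j) {x y : S} (hxy : x ⋏ y = y) : x ⋎ y = x := by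
  rw [← hxy, h.self_join_meet]

theorem join_eq_right (h : IsSkewLattice m j) {x y : S} (hxy : x ⋏ y = x) : x ⋎ y = y := by
  rw [← hxy, h.meet_join_self]

theorem meet_eq_left (h : IsSkewLattice m j) {x y : S} (hxy : x ⋎ y = y) : x ⋏ y = x := by
  rw [← hxy, h.self_meet_join]

theorem meet_eq_right (h : IsSkewLattice m j) {x y : S} (hxy : x ⋎ y = x) : x ⋏ y = y := by
  rw [← hxy, h.join_meet_self]

theorem join_join_eq_of_meet_meet_eq (h : IsSkewLattice m j) {b c : S}
    (hc : c ⋏ b ⋏ c = c) : b ⋎ c ⋎ b = b := by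
  have := h.meet_associative
  have hb := h.meet_self b
  have hcc := h.meet_self c
  have hbc := h.meet_self (b ⋏ c)
  have hce : c ⋏ (c ⋏ b) = c ⋏ b := by grind only
  have hfe : b ⋏ c ⋏ b ⋏ (c ⋏ b) = b ⋏ c ⋏ b := by grind only
  have hef : c ⋏ b ⋏ (b ⋏ c ⋏ b) = c ⋏ b := by grind only
  have hfc : b ⋏ c ⋏ b ⋎ c = c ⋏ b :=
    mul_eq_of_greenR_of_greenL h.join_assoc h.dual.meet_self
      (h.join_eq_right hfe) (h.join_eq_right hef) (h.join_eq_left hc) (h.join_eq_left hce)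
  have hbf : b ⋎ b ⋏ c ⋏ b = b := by rw [← h.meet_assoc, h.self_join_meet]
  have hfb : b ⋏ c ⋏ b ⋎ b = b := h.meet_join_self _ _
  calc b ⋎ c ⋎ b = b ⋎ b ⋏ c ⋏ b ⋎ c ⋎ (b ⋏ c ⋏ b ⋎ b) := by rw [hbf, hfb]
    _ = b ⋎ (b ⋏ c ⋏ b ⋎ c ⋎ b ⋏ c ⋏ b) ⋎ b := by simp only [h.join_assoc]
    _ = b := by rw [hfc, h.join_eq_right hef, hbf, h.dual.meet_self]

/-- Green's relation `R` of the band `m`. -/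
def GreenR (m : S → S → S) (a b : S) : Prop := m a b = b ∧ m b a = a

theorem meet_meet_meet_eq (h : IsSkewLattice m j) {a b : S} (hab : GreenR m a b) (c : S) :
    a ⋏ c ⋏ (b ⋏ c) = b ⋏ c := by
  have := h.meet_associative
  obtain ⟨hab, hba⟩ := hab
  have hbc := h.meet_self (b ⋏ c)
  have hcb := h.meet_self (c ⋏ b)
  have hcc := h.meet_self c
  have hd : b ⋎ c ⋏ b ⋏ c ⋎ b = b := h.join_join_eq_of_meet_meet_eq (by grind only)
  have hb := mul_eq_of_greenR_of_greenL h.meet_assoc h.meet_self hab hba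
    (h.self_meet_join b (c ⋏ b ⋏ c)) (h.meet_eq_left hd)
  have hc := h.join_meet_self (c ⋏ b ⋏ c) b
  have : a ⋏ (c ⋏ b ⋏ c) = b ⋏ (c ⋏ b ⋏ c) := by
    conv_lhs => rw [← hc, h.meet_assoc, hb]
  grind only

theorem greenR_equivalence (h : IsSkewLattice m j) : Equivalence (GreenR m) where
  refl x := ⟨h.meet_self x, h.meet_self x⟩
  symm hab := hab.symm
  trans := by
    rintro a b c ⟨hab, hba⟩ ⟨hbc, hcb⟩
    exact ⟨by rw [← hbc, h.meet_assoc, hab], by rw [← hba, h.meet_assoc, hcb]⟩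

theorem greenR_meet (h : IsSkewLattice m j) {a b c d : S} (hab : GreenR m a b)
    (hcd : GreenR m c d) : GreenR m (a ⋏ c) (b ⋏ d) := by
  refine h.greenR_equivalence.trans
    ⟨h.meet_meet_meet_eq hab c, h.meet_meet_meet_eq hab.symm c⟩ ?_
  have := h.meet_associative
  have hbc := h.meet_self (b ⋏ c)
  have hbd := h.meet_self (b ⋏ d)
  obtain ⟨hcd, hdc⟩ := hcd
  constructor <;> grind only

theorem greenR_reverse_dual (h : IsSkewLattice m j) {a b : S} :
    GreenR (fun x y => j y x) a b ↔ GreenR m a b :=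
  ⟨fun hab => ⟨h.meet_eq_right hab.2, h.meet_eq_right hab.1⟩,
    fun hab => ⟨h.join_eq_left hab.2, h.join_eq_left hab.1⟩⟩

theorem greenR_join (h : IsSkewLattice m j) {a b c d : S} (hab : GreenR m a b)
    (hcd : GreenR m c d) : GreenR m (a ⋎ c) (b ⋎ d) :=
  h.greenR_reverse_dual.1 <| h.dual.reverse.greenR_meet
    (h.greenR_reverse_dual.2 hcd) (h.greenR_reverse_dual.2 hab)

/-- Green's relation `R` of the meet band of a skew lattice, as a setoid. -/
def greenRSetoid (h : IsSkewLattice m j) : Setoid S := ⟨GreenR m, h.greenR_equivalence⟩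

/-- The identity `x ∧ y ∧ (x ∨ y ∨ x) = (x ∨ y ∨ x) ∧ y ∧ x`. -/
def LowerSymmetric (m j : S → S → S) : Prop :=
  ∀ x y : S, m (m x y) (j (j x y) x) = m (m (j (j x y) x) y) x

/-- The identity `x ∧ (y ∨ z) ∧ x = (x ∧ y ∧ x) ∨ (x ∧ z ∧ x)`. -/
def MiddleDistributive (m j : S → S → S) : Prop :=
  ∀ x y z : S, m (m x (j y z)) x = j (m (m x y) x) (m (m x z) x)

/-- In a left-handed skew lattice the two assumptions give `(y ∧ z) ∨ x = (y ∨ x) ∧ z` whenever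
`x ≤ z`. -/
theorem join_eq_meet_of_le (h : IsSkewLattice m j) (hj : ∀ x y, x ⋎ y ⋎ x = y ⋎ x)
    (sym : ∀ x y, (y ⋎ x) ⋏ y ⋏ x = x ⋏ y) (dist : ∀ x y z, x ⋏ (y ⋎ z) = x ⋏ y ⋎ x ⋏ z)
    {x z : S} (hxz : x ⋎ z = z) (hzx : z ⋎ x = z) (y : S) : y ⋏ z ⋎ x = (y ⋎ x) ⋏ z := by
  have hz : z ⋏ x = x := h.meet_eq_right hzx
  have hs : y ⋎ x ⋎ z = y ⋎ z := by rw [← h.join_assoc, hxz]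
  have hsx : (y ⋎ z) ⋏ x = x := h.meet_eq_right (by rw [← h.join_assoc, hzx])
  have key : (y ⋎ z) ⋏ (y ⋏ z ⋎ x) = (y ⋎ z) ⋏ ((y ⋎ x) ⋏ z) := by
    have h1 := sym z (y ⋎ x)
    rw [hs] at h1
    rw [dist, hsx, h.meet_assoc, sym z y, h.meet_assoc, h1, dist, hz]
  have hys : (y ⋎ x) ⋏ (y ⋎ z) = y ⋎ x := by rw [← hs, h.self_meet_join]
  have hyu : y ⋎ x ⋎ (y ⋏ z ⋎ x) = y ⋎ x := by
    calc y ⋎ x ⋎ (y ⋏ z ⋎ x) = y ⋎ (x ⋎ y ⋏ z ⋎ x) := by simp only [h.join_assoc]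
      _ = y ⋎ x := by rw [hj, h.join_assoc, h.self_join_meet]
  calc y ⋏ z ⋎ x = (y ⋎ x) ⋏ (y ⋏ z ⋎ x) := (h.meet_eq_right hyu).symm
    _ = (y ⋎ x) ⋏ ((y ⋎ z) ⋏ (y ⋏ z ⋎ x)) := by rw [h.meet_assoc, hys]
    _ = (y ⋎ x) ⋏ z := by rw [key, h.meet_assoc, hys, h.meet_assoc, h.meet_self]

theorem middleDistributive_dual_of_leftHanded (h : IsSkewLattice m j)
    (hm : ∀ x y, x ⋏ y ⋏ x = x ⋏ y) (hj : ∀ x y, x ⋎ y ⋎ x = y ⋎ x)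
    (sym : LowerSymmetric m j) (dist : MiddleDistributive m j) : MiddleDistributive j m := by
  have sym' (x y : S) : (y ⋎ x) ⋏ y ⋏ x = x ⋏ y := by
    have := sym x y
    rw [hj, ← h.meet_assoc, h.self_meet_join] at this
    exact this.symm
  have dist' (x y z : S) : x ⋏ (y ⋎ z) = x ⋏ y ⋎ x ⋏ z := by
    simpa only [hm] using dist x y z
  intro x y z
  simp only [hj]
  rw [← h.join_eq_meet_of_le hj sym' dist' (by rw [h.join_assoc, hj])
    (by rw [← h.join_assoc, h.dual.meet_self]) y, dist', ← h.join_assoc, h.meet_join_self]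

theorem greenR_join_of_lowerSymmetric (h : IsSkewLattice m j) (sym : LowerSymmetric m j)
    (dist : MiddleDistributive m j) (x y z : S) :
    GreenR m (x ⋎ y ⋏ z ⋎ x) ((x ⋎ y ⋎ x) ⋏ (x ⋎ z ⋎ x)) := by
  let := h.greenRSetoid
  let m' : Quotient h.greenRSetoid → _ → _ :=
    Quotient.map₂ m fun _ _ hab _ _ hcd => h.greenR_meet hab hcd
  let j' : Quotient h.greenRSetoid → _ → _ :=
    Quotient.map₂ j fun _ _ hab _ _ hcd => h.greenR_join hab hcd
  have hq : IsSkewLattice m' j' := by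
    refine ⟨?_, ?_, ?_, ?_, ?_, ?_⟩
    · rintro ⟨x⟩ ⟨y⟩ ⟨z⟩
      exact congrArg (Quotient.mk _) (h.meet_assoc x y z)
    · rintro ⟨x⟩ ⟨y⟩ ⟨z⟩
      exact congrArg (Quotient.mk _) (h.join_assoc x y z)
    · rintro ⟨x⟩ ⟨y⟩
      exact congrArg (Quotient.mk _) (h.meet_join_self x y)
    · rintro ⟨x⟩ ⟨y⟩
      exact congrArg (Quotient.mk _) (h.self_meet_join x y)
    · rintro ⟨x⟩ ⟨y⟩
      exact congrArg (Quotient.mk _) (h.join_meet_self x y)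
    · rintro ⟨x⟩ ⟨y⟩
      exact congrArg (Quotient.mk _) (h.self_join_meet x y)
  have hm (x y : Quotient h.greenRSetoid) : m' (m' x y) x = m' x y := by
    rcases x with ⟨x⟩
    rcases y with ⟨y⟩
    have := h.meet_associative
    have hxy := h.meet_self (x ⋏ y)
    have hx := h.meet_self x
    refine Quotient.sound (s := h.greenRSetoid) ⟨?_, ?_⟩ <;> grind only
  have hj (x y : Quotient h.greenRSetoid) : j' (j' x y) x = j' y x := by
    rcases x with ⟨x⟩
    rcases y with ⟨y⟩
    have := h.dual.meet_associative
    have hyx := h.dual.meet_self (y ⋎ x)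
    have hx := h.dual.meet_self x
    refine Quotient.sound (s := h.greenRSetoid) (h.greenR_reverse_dual.1 ⟨?_, ?_⟩) <;> grind only
  have hd := hq.middleDistributive_dual_of_leftHanded hm hj
    (by rintro ⟨x⟩ ⟨y⟩; exact congrArg (Quotient.mk _) (sym x y))
    (by rintro ⟨x⟩ ⟨y⟩ ⟨z⟩; exact congrArg (Quotient.mk _) (dist x y z))
  exact Quotient.exact (s := h.greenRSetoid) (hd ⟦x⟧ ⟦y⟧ ⟦z⟧)

theorem middleDistributive_dual (h : IsSkewLattice m j) (sym : LowerSymmetric m j)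
    (dist : MiddleDistributive m j) : MiddleDistributive j m := by
  intro x y z
  have hR := (h.greenR_join_of_lowerSymmetric sym dist x y z).2
  have hL := (h.reverse.greenR_join_of_lowerSymmetric
    (fun x y => by simpa only [h.meet_assoc, h.join_assoc] using (sym x y).symm)
    (fun x y z => by simpa only [h.meet_assoc, h.join_assoc] using dist x z y) x z y).1
  simp only [h.join_assoc] at hL
  exact hR.symm.trans hL

end IsSkewLattice


/-- In any skew lattice:
(a) lower symmetry `x∧y∧(x∨y∨x) = (x∨y∨x)∧y∧x` together with ∧-middle-distributivity
    `x∧(y∨z)∧x = (x∧y∧x)∨(x∧z∧x)` imply ∨-middle-distributivity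
    `x∨(y∧z)∨x = (x∨y∨x)∧(x∨z∨x)`; and
(b) upper symmetry `x∨y∨(x∧y∧x) = (x∧y∧x)∨y∨x` together with ∨-middle-distributivity
    imply ∧-middle-distributivity.
Here `mt` is ∧ and `jn` is ∨. -/
theorem skew_lattice_symmetry_middle_distributivity
    {S : Type*} (mt jn : S → S → S)
    (mt_assoc : ∀ x y z : S, mt x (mt y z) = mt (mt x y) z)
    (jn_assoc : ∀ x y z : S, jn x (jn y z) = jn (jn x y) z)
    (abs1 : ∀ x y : S, jn (mt y x) x = x)
    (abs2 : ∀ x y : S, mt x (jn x y) = x)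
    (abs3 : ∀ x y : S, mt (jn y x) x = x)
    (abs4 : ∀ x y : S, jn x (mt x y) = x) :
    (((∀ x y : S, mt (mt x y) (jn (jn x y) x) = mt (mt (jn (jn x y) x) y) x) →
      (∀ x y z : S, mt (mt x (jn y z)) x = jn (mt (mt x y) x) (mt (mt x z) x)) →
      (∀ x y z : S, jn (jn x (mt y z)) x = mt (jn (jn x y) x) (jn (jn x z) x)))
    ∧ ((∀ x y : S, jn (jn x y) (mt (mt x y) x) = jn (jn (mt (mt x y) x) y) x) →
      (∀ x y z : S, jn (jn x (mt y z)) x = mt (jn (jn x y) x) (jn (jn x z) x)) →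
      (∀ x y z : S, mt (mt x (jn y z)) x = jn (mt (mt x y) x) (mt (mt x z) x)))) := by
  have h : IsSkewLattice mt jn := ⟨mt_assoc, jn_assoc, abs1, abs2, abs3, abs4⟩
  exact ⟨h.middleDistributive_dual, h.dual.middleDistributive_dual⟩
end

section
/- In any skew lattice S, Green's relations L and R are congruences: if x L x' and y L y' then (x∧y) L (x'∧y') and (x∨y) L (x'∨y'), and similarly for R. Moreover, the quotient S/L is right-handed and S/R is left-handed: for all x,y, (x∧y∧x) L (y∧x), (x∨y∨x) L (x∨y), (x∧y∧x) R (x∧y), and (x∨y∨x) R (y∨x). -/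
/-- Green's relation R on a skew lattice (`mt` = ∧): x R y iff x∧y = y and y∧x = x. -/
def GreenR {S : Type*} (mt : S → S → S) (x y : S) : Prop :=
  mt x y = y ∧ mt y x = x

/-- Green's relation L on a skew lattice (`mt` = ∧): x L y iff x∧y = x and y∧x = y. -/
def GreenL {S : Type*} (mt : S → S → S) (x y : S) : Prop :=
  mt x y = x ∧ mt y x = y

/-- The skew lattice axioms for a meet `mt` and a join `jn`. -/
structure IsSkewLattice_s15 {S : Type*} (mt jn : S → S → S) : Prop where
  mt_assoc : ∀ x y z : S, mt x (mt y z) = mt (mt x y) z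
  jn_assoc : ∀ x y z : S, jn x (jn y z) = jn (jn x y) z
  jn_mt_left : ∀ x y : S, jn (mt y x) x = x
  mt_jn_right : ∀ x y : S, mt x (jn x y) = x
  mt_jn_left : ∀ x y : S, mt (jn y x) x = x
  jn_mt_right : ∀ x y : S, jn x (mt x y) = x

namespace IsSkewLattice_s15

variable {S : Type*} {mt jn : S → S → S}

/-- Exchanging meet and join gives a skew lattice. -/
theorem dual_s15 (h : IsSkewLattice_s15 mt jn) : IsSkewLattice_s15 jn mt :=
  ⟨h.jn_assoc, h.mt_assoc, h.mt_jn_left, h.jn_mt_right, h.jn_mt_left, h.mt_jn_right⟩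

/-- Reversing the arguments of both operations gives a skew lattice. -/
theorem op (h : IsSkewLattice_s15 mt jn) :
    IsSkewLattice_s15 (fun x y => mt y x) (fun x y => jn y x) :=
  ⟨fun x y z => (h.mt_assoc z y x).symm, fun x y z => (h.jn_assoc z y x).symm,
    h.jn_mt_right, h.mt_jn_left, h.mt_jn_right, h.jn_mt_left⟩

theorem mt_self (h : IsSkewLattice_s15 mt jn) (x : S) : mt x x = x := by
  have := h.mt_jn_right x (mt x x)
  rwa [h.jn_mt_right] at this

theorem mt_eq_left_iff (h : IsSkewLattice_s15 mt jn) {x y : S} : mt x y = x ↔ jn x y = y :=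
  ⟨fun e => by simpa only [e] using h.jn_mt_left y x,
    fun e => by simpa only [e] using h.mt_jn_right x y⟩

theorem mt_eq_right_iff (h : IsSkewLattice_s15 mt jn) {x y : S} : mt x y = y ↔ jn x y = x :=
  ⟨fun e => by simpa only [e] using h.jn_mt_right x y,
    fun e => by simpa only [e] using h.mt_jn_left y x⟩

theorem greenL_iff_greenR_dual (h : IsSkewLattice_s15 mt jn) {x y : S} :
    GreenL mt x y ↔ GreenR jn x y :=
  and_congr h.mt_eq_left_iff h.mt_eq_left_iff

theorem greenR_iff_greenL_dual (h : IsSkewLattice_s15 mt jn) {x y : S} :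
    GreenR mt x y ↔ GreenL jn x y :=
  h.dual_s15.greenL_iff_greenR_dual.symm

theorem greenR_iff_greenL_op {x y : S} : GreenR mt x y ↔ GreenL (fun x y => mt y x) x y :=
  and_comm

theorem greenL_mt_mt_self (h : IsSkewLattice_s15 mt jn) (x y : S) :
    GreenL mt (mt (mt x y) x) (mt y x) := by
  have hm := h.mt_assoc
  have hi := h.mt_self
  constructor <;> grind

theorem greenR_mt_mt_self (h : IsSkewLattice_s15 mt jn) (x y : S) :
    GreenR mt (mt (mt x y) x) (mt x y) := by
  have hm := h.mt_assoc
  have hi := h.mt_self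
  constructor <;> grind

/-- The join of `x ∧ z` and `z ∧ x` is `z ∧ x ∧ z`. -/
theorem jn_mt_mt (h : IsSkewLattice_s15 mt jn) (x z : S) :
    jn (mt x z) (mt z x) = mt (mt z x) z := by
  have hj := h.jn_assoc
  have h1 := (h.greenL_iff_greenR_dual.1 (h.greenL_mt_mt_self z x)).2
  have h2 := (h.greenR_iff_greenL_dual.1 (h.greenR_mt_mt_self z x)).2
  have h3 := (h.greenL_iff_greenR_dual.1 (h.greenL_mt_mt_self x z)).2
  have h4 := (h.greenR_iff_greenL_dual.1 (h.greenR_mt_mt_self x z)).2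
  generalize mt (mt z x) z = r at *
  generalize mt (mt x z) x = s at *
  generalize mt x z = p at *
  generalize mt z x = q at *
  have hr : jn (jn p q) r = jn p q := by rw [← hj, h2]
  have hs : jn (jn p q) s = p := by rw [← hj, h3, h4]
  calc jn p q = jn (jn p q) (jn p r) := by rw [h1, hr]
    _ = jn (jn p q) (jn (jn (jn p q) s) r) := by rw [hs]
    _ = jn (jn (jn (jn p q) (jn p q)) s) r := by rw [hj, hj]
    _ = r := by rw [h.dual_s15.mt_self, hs, h1]

theorem jn_jn_mt_mt (h : IsSkewLattice_s15 mt jn) (x z : S) :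
    jn x (jn (mt (mt z x) z) x) = x := by
  rw [← h.jn_mt_mt, ← h.jn_assoc, h.jn_mt_left, h.jn_assoc, h.jn_mt_right, h.dual_s15.mt_self]

/-- `GreenL` is compatible with meeting on the left. -/
theorem mt_mt_mt_of_greenL (h : IsSkewLattice_s15 mt jn) {x y : S} (z : S)
    (hxy : GreenL mt x y) : mt (mt z x) (mt z y) = mt z x := by
  have hm := h.mt_assoc
  have hi := h.mt_self
  have hb : mt (mt (mt z x) z) (jn (mt (mt z x) z) x) = mt (mt z x) z := h.mt_jn_right _ _
  have htx : mt (jn (mt (mt z x) z) x) x = x := h.mt_jn_left _ _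
  have hxt : mt x (jn (mt (mt z x) z) x) = jn (mt (mt z x) z) x :=
    h.mt_eq_right_iff.2 (h.jn_jn_mt_mt x z)
  obtain ⟨h1, h2⟩ := hxy
  generalize jn (mt (mt z x) z) x = t at *
  have hty : mt t y = x := by
    calc mt t y = mt (mt t x) y := by
          rw [htx, h1]; grind
      _ = x := by rw [htx, h1]
  calc mt (mt z x) (mt z y) = mt (mt (mt (mt z x) z) t) y := by rw [hb, hm]
    _ = mt (mt (mt z x) z) x := by rw [← hm, hty]
    _ = mt z x := by rw [← hm, hi]

theorem greenL_mt (h : IsSkewLattice_s15 mt jn) {x x' y y' : S}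
    (hx : GreenL mt x x') (hy : GreenL mt y y') : GreenL mt (mt x y) (mt x' y') := by
  have hm := h.mt_assoc
  have key : ∀ {x x' y y' : S}, GreenL mt x x' → GreenL mt y y' →
      mt (mt x y) (mt x' y') = mt x y := by
    intro x x' y y' hx hy
    have e := h.mt_mt_mt_of_greenL x' hy
    calc mt (mt x y) (mt x' y') = mt (mt x (mt x' y)) (mt x' y') := by
          rw [hm x x' y, hx.1]
      _ = mt x y := by rw [← hm, e, hm, hx.1]
  exact ⟨key hx hy, key ⟨hx.2, hx.1⟩ ⟨hy.2, hy.1⟩⟩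

theorem greenR_mt (h : IsSkewLattice_s15 mt jn) {x x' y y' : S}
    (hx : GreenR mt x x') (hy : GreenR mt y y') : GreenR mt (mt x y) (mt x' y') :=
  greenR_iff_greenL_op.2
    (h.op.greenL_mt (greenR_iff_greenL_op.1 hy) (greenR_iff_greenL_op.1 hx))

theorem greenL_jn (h : IsSkewLattice_s15 mt jn) {x x' y y' : S}
    (hx : GreenL mt x x') (hy : GreenL mt y y') : GreenL mt (jn x y) (jn x' y') :=
  h.greenL_iff_greenR_dual.2
    (h.dual_s15.greenR_mt (h.greenL_iff_greenR_dual.1 hx) (h.greenL_iff_greenR_dual.1 hy))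

theorem greenR_jn (h : IsSkewLattice_s15 mt jn) {x x' y y' : S}
    (hx : GreenR mt x x') (hy : GreenR mt y y') : GreenR mt (jn x y) (jn x' y') :=
  h.greenR_iff_greenL_dual.2
    (h.dual_s15.greenL_mt (h.greenR_iff_greenL_dual.1 hx) (h.greenR_iff_greenL_dual.1 hy))

end IsSkewLattice_s15

/-- In any skew lattice, Green's relations L and R are congruences; moreover S/L is
right-handed and S/R is left-handed: (x∧y∧x) L (y∧x), (x∨y∨x) L (x∨y),
(x∧y∧x) R (x∧y) and (x∨y∨x) R (y∨x). Here `mt` is ∧ and `jn` is ∨. -/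
theorem greenLR_congruences_and_quotient_handedness
    {S : Type*} (mt jn : S → S → S)
    (mt_assoc : ∀ x y z : S, mt x (mt y z) = mt (mt x y) z)
    (jn_assoc : ∀ x y z : S, jn x (jn y z) = jn (jn x y) z)
    (abs1 : ∀ x y : S, jn (mt y x) x = x)
    (abs2 : ∀ x y : S, mt x (jn x y) = x)
    (abs3 : ∀ x y : S, mt (jn y x) x = x)
    (abs4 : ∀ x y : S, jn x (mt x y) = x) :
    (∀ x x' y y' : S, GreenL mt x x' → GreenL mt y y' →
      GreenL mt (mt x y) (mt x' y') ∧ GreenL mt (jn x y) (jn x' y'))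
    ∧
    (∀ x x' y y' : S, GreenR mt x x' → GreenR mt y y' →
      GreenR mt (mt x y) (mt x' y') ∧ GreenR mt (jn x y) (jn x' y'))
    ∧
    (∀ x y : S,
      GreenL mt (mt (mt x y) x) (mt y x) ∧
      GreenL mt (jn (jn x y) x) (jn x y) ∧
      GreenR mt (mt (mt x y) x) (mt x y) ∧
      GreenR mt (jn (jn x y) x) (jn y x)) := by
  have h : IsSkewLattice_s15 mt jn := ⟨mt_assoc, jn_assoc, abs1, abs2, abs3, abs4⟩
  exact ⟨fun _ _ _ _ hx hy => ⟨h.greenL_mt hx hy, h.greenL_jn hx hy⟩,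
    fun _ _ _ _ hx hy => ⟨h.greenR_mt hx hy, h.greenR_jn hx hy⟩,
    fun x y => ⟨h.greenL_mt_mt_self x y,
      h.greenL_iff_greenR_dual.2 (h.dual_s15.greenR_mt_mt_self x y),
      h.greenR_mt_mt_self x y,
      h.greenR_iff_greenL_dual.2 (h.dual_s15.greenL_mt_mt_self x y)⟩⟩
end
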